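/- arXiv:2605.26243 — 7 statements merged into one kernel-verified Lean document; each statement's English description precedes it below -/
import Mathlib

section
/- Let n ≥ 1, R' ≥ 1 be natural numbers, σ₀ > 0, δ ∈ (0,1), ρ > 0 and α > 1 be real numbers. For v, v' : Fin n → ℝ with ∑ i, (v i − v' i)² ≤ ρ², and for every measurable set S of functions (Fin R' × Fin n) → ℝ, the composed Gaussian mechanism satisfies M(v)(S) ≤ exp( R'·α·ρ²/(2σ₀²) + log((α−1)/α) − log(δ·α)/(α−1) ) · M(v')(S) + δ. -/
open MeasureTheory ProbabilityTheory Real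

/-- The composed Gaussian mechanism: `R'` independent releases of the vector `v : Fin n → ℝ`,
each perturbed by independent `N(0, σ₀² I_n)` noise. -/
noncomputable def composedGaussian (R' n : ℕ) (σ₀ : ℝ) (v : Fin n → ℝ) :
    Measure ((Fin R' × Fin n) → ℝ) :=
  Measure.pi fun p => gaussianReal (v p.2) (Real.toNNReal (σ₀ ^ 2))

open scoped ENNReal NNReal

/-- The shift of a real Gaussian measure as an exponential change of density. -/
lemma gaussianReal_add_eq_withDensity (m a : ℝ) {s : ℝ≥0} (hs : s ≠ 0) :
    gaussianReal (m + a) s = (gaussianReal m s).withDensity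
      fun x ↦ ENNReal.ofReal (exp (a * (x - m) / s - a ^ 2 / (2 * s))) := by
  have hs' : (s : ℝ) ≠ 0 := by exact_mod_cast hs
  rw [gaussianReal_of_var_ne_zero _ hs, gaussianReal_of_var_ne_zero _ hs,
    ← withDensity_mul _ (measurable_gaussianPDF m s) (by fun_prop)]
  congr 1
  ext x
  rw [Pi.mul_apply, gaussianPDF, gaussianPDF, ← ENNReal.ofReal_mul (gaussianPDFReal_nonneg _ _ _),
    gaussianPDFReal, gaussianPDFReal, mul_assoc _ (exp _) (exp _), ← exp_add]
  congr 3
  field_simp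
  ring

/-- Integrating a product of functions of the single coordinates over a product of probability
measures. -/
lemma lintegral_pi_prod {ι : Type*} [Fintype ι] {X : ι → Type*} [∀ i, MeasurableSpace (X i)]
    (μ : ∀ i, Measure (X i)) [∀ i, IsProbabilityMeasure (μ i)] {f : ∀ i, X i → ℝ≥0∞}
    (hf : ∀ i, Measurable (f i)) :
    ∫⁻ x, ∏ i, f i (x i) ∂Measure.pi μ = ∏ i, ∫⁻ x, f i x ∂μ i := by
  have hind := iIndepFun_pi (μ := μ) (X := f) fun i ↦ (hf i).aemeasurable
  rw [lintegral_prod_eq_prod_lintegral_of_indepFun Finset.univ _ hind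
    fun i ↦ (hf i).comp (measurable_pi_apply i)]
  refine Finset.prod_congr rfl fun i _ ↦ ?_
  exact (measurePreserving_eval μ i).lintegral_comp (hf i)

/-- A product of measures with densities has the product density. -/
lemma pi_withDensity {ι : Type*} [Fintype ι] {X : ι → Type*} [∀ i, MeasurableSpace (X i)]
    (μ : ∀ i, Measure (X i)) [∀ i, IsProbabilityMeasure (μ i)] {f : ∀ i, X i → ℝ≥0∞}
    (hf : ∀ i, Measurable (f i)) [∀ i, SigmaFinite ((μ i).withDensity (f i))] :
    Measure.pi (fun i ↦ (μ i).withDensity (f i)) =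
      (Measure.pi μ).withDensity fun x ↦ ∏ i, f i (x i) := by
  refine Measure.pi_eq fun t ht ↦ ?_
  rw [withDensity_apply _ (MeasurableSet.univ_pi ht),
    ← lintegral_indicator (MeasurableSet.univ_pi ht)]
  simp_rw [withDensity_apply _ (ht _), ← lintegral_indicator (ht _)]
  rw [← lintegral_pi_prod μ fun i ↦ (hf i).indicator (ht i)]
  congr 1
  ext x
  by_cases hx : x ∈ Set.univ.pi t
  · rw [Set.indicator_of_mem hx]
    exact Finset.prod_congr rfl fun i _ ↦ (Set.indicator_of_mem (hx i trivial) _).symm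
  · rw [Set.indicator_of_notMem hx]
    obtain ⟨i, hi⟩ : ∃ i, x i ∉ t i := by simpa [Set.mem_pi] using hx
    exact (Finset.prod_eq_zero (Finset.mem_univ i) (Set.indicator_of_notMem hi _)).symm

/-- The shift of a product of Gaussian measures as an exponential change of density. -/
lemma pi_gaussianReal_add_eq_withDensity {ι : Type*} [Fintype ι] (m a : ι → ℝ) {s : ℝ≥0}
    (hs : s ≠ 0) :
    Measure.pi (fun i ↦ gaussianReal (m i + a i) s) =
      (Measure.pi fun i ↦ gaussianReal (m i) s).withDensity fun x ↦
        ENNReal.ofReal (exp (∑ i, a i * (x i - m i) / s - ∑ i, a i ^ 2 / (2 * s))) := by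
  have (i : ι) : SigmaFinite ((gaussianReal (m i) s).withDensity
      fun x ↦ ENNReal.ofReal (exp (a i * (x - m i) / s - a i ^ 2 / (2 * s)))) := by
    rw [← gaussianReal_add_eq_withDensity _ _ hs]
    infer_instance
  simp_rw [gaussianReal_add_eq_withDensity _ _ hs]
  rw [pi_withDensity _ fun i ↦ by fun_prop]
  simp_rw [← Finset.sum_sub_distrib, exp_sum,
    ENNReal.ofReal_prod_of_nonneg fun i _ ↦ (exp_pos _).le]

/-- Young's inequality in the form that converts Rényi bounds into `(ε, δ)` bounds. -/
lemma exp_le_exp_add_mul_exp {α δ : ℝ} (hα : 1 < α) (hδ : 0 < δ) (τ y : ℝ) :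
    exp y ≤ exp (τ + log ((α - 1) / α) - log (δ * α) / (α - 1)) +
      δ * exp (α * y - (α - 1) * τ) := by
  have hα0 : 0 < α := by linarith
  have hα1 : 0 < α - 1 := by linarith
  have h := convexOn_exp.2 (Set.mem_univ (τ - log (δ * α) / (α - 1)))
    (Set.mem_univ (α * y - (α - 1) * τ + log (δ * α)))
    (show 0 ≤ (α - 1) / α by positivity) (show 0 ≤ 1 / α by positivity) (by field_simp; simp)
  simp only [smul_eq_mul] at h
  have hy : (α - 1) / α * (τ - log (δ * α) / (α - 1)) +
      1 / α * (α * y - (α - 1) * τ + log (δ * α)) = y := by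
    field_simp
    ring
  have hδ' : 1 / α * exp (α * y - (α - 1) * τ + log (δ * α)) =
      δ * exp (α * y - (α - 1) * τ) := by
    rw [exp_add, exp_log (by positivity)]
    field_simp
  rwa [hy, hδ', ← exp_log (show 0 < (α - 1) / α by positivity), ← exp_add, add_sub_left_comm,
    ← add_sub_assoc] at h

theorem composed_gaussian_metric_dp_at_order
    (n R' : ℕ) (hn : 1 ≤ n) (hR : 1 ≤ R')
    (σ₀ δ ρ α : ℝ) (hσ : 0 < σ₀) (hδ0 : 0 < δ) (hδ1 : δ < 1) (hρ : 0 < ρ) (hα : 1 < α)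
    (v v' : Fin n → ℝ) (hvv' : ∑ i, (v i - v' i) ^ 2 ≤ ρ ^ 2)
    (S : Set ((Fin R' × Fin n) → ℝ)) (hS : MeasurableSet S) :
    composedGaussian R' n σ₀ v S ≤
      ENNReal.ofReal (Real.exp ((R' : ℝ) * α * ρ ^ 2 / (2 * σ₀ ^ 2)
          + Real.log ((α - 1) / α) - Real.log (δ * α) / (α - 1))) *
        composedGaussian R' n σ₀ v' S + ENNReal.ofReal δ := by
  have hs : (σ₀ ^ 2).toNNReal ≠ 0 := by simp [hσ.ne']
  have hs_coe : ((σ₀ ^ 2).toNNReal : ℝ) = σ₀ ^ 2 := Real.coe_toNNReal _ (sq_nonneg _)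
  set m : Fin R' × Fin n → ℝ := fun p ↦ v' p.2 with hm
  set d : Fin R' × Fin n → ℝ := fun p ↦ v p.2 - v' p.2 with hd
  set D : ℝ := ∑ p, d p ^ 2 / (2 * σ₀ ^ 2) with hD
  have hDle : D ≤ R' * ρ ^ 2 / (2 * σ₀ ^ 2) := by
    rw [hD, ← Finset.sum_div, Fintype.sum_prod_type]
    simp only [hd, Finset.sum_const, Finset.card_univ, Fintype.card_fin, nsmul_eq_mul]
    gcongr
  set Q := composedGaussian R' n σ₀ v' with hQ
  have hL : composedGaussian R' n σ₀ v = Q.withDensity fun x ↦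
      ENNReal.ofReal (exp (∑ p, d p * (x p - m p) / σ₀ ^ 2 - D)) := by
    have h := pi_gaussianReal_add_eq_withDensity m d hs
    simp only [hs_coe, hm, hd, add_sub_cancel] at h
    exact h
  let T : (Fin R' × Fin n → ℝ) → ℝ≥0∞ := fun x ↦
    ENNReal.ofReal (exp (α * ∑ p, d p * (x p - m p) / σ₀ ^ 2 - α ^ 2 * D))
  have hT : ∫⁻ x, T x ∂Q = 1 := by
    have h := congrArg (· Set.univ) (pi_gaussianReal_add_eq_withDensity m (fun p ↦ α * d p) hs)
    simp only [measure_univ, withDensity_apply _ MeasurableSet.univ, Measure.restrict_univ,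
      hs_coe] at h
    rw [h]
    simp only [T, hD, Finset.mul_sum, mul_pow, mul_assoc, mul_div_assoc]
    rfl
  set ε := (R' : ℝ) * α * ρ ^ 2 / (2 * σ₀ ^ 2) + log ((α - 1) / α) - log (δ * α) / (α - 1)
    with hε
  have hpt (x : Fin R' × Fin n → ℝ) :
      ENNReal.ofReal (exp (∑ p, d p * (x p - m p) / σ₀ ^ 2 - D)) ≤
        ENNReal.ofReal (exp ε) + ENNReal.ofReal δ * T x := by
    rw [← ENNReal.ofReal_mul hδ0.le, ← ENNReal.ofReal_add (exp_pos _).le (by positivity)]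
    refine ENNReal.ofReal_le_ofReal ((exp_le_exp_add_mul_exp hα hδ0
      (R' * α * ρ ^ 2 / (2 * σ₀ ^ 2)) _).trans ?_)
    refine add_le_add le_rfl (mul_le_mul_of_nonneg_left (exp_le_exp.2 ?_) hδ0.le)
    have := mul_le_mul_of_nonneg_left hDle (by nlinarith : 0 ≤ α * (α - 1))
    linear_combination this
  calc composedGaussian R' n σ₀ v S
      ≤ ∫⁻ x in S, (ENNReal.ofReal (exp ε) + ENNReal.ofReal δ * T x) ∂Q := by
        rw [hL, withDensity_apply _ hS]
        exact lintegral_mono hpt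
    _ = ENNReal.ofReal (exp ε) * Q S + ENNReal.ofReal δ * ∫⁻ x in S, T x ∂Q := by
        rw [lintegral_add_left measurable_const, setLIntegral_const,
          lintegral_const_mul _ (by fun_prop)]
    _ ≤ ENNReal.ofReal (exp ε) * Q S + ENNReal.ofReal δ * ∫⁻ x, T x ∂Q := by
        gcongr
        exact Measure.restrict_le_self
    _ = ENNReal.ofReal (exp ε) * Q S + ENNReal.ofReal δ := by rw [hT, mul_one]
end

section
/- Let n ≥ 1, R' ≥ 1 be natural numbers, σ₀ > 0, δ ∈ (0,1), ρ > 0 be real numbers, and set ε(ρ) = inf over α ∈ (1,∞) of [ R'·α·ρ²/(2σ₀²) + log((α−1)/α) − log(δ·α)/(α−1) ] (this infimum is a finite real number). Then for all v, v' : Fin n → ℝ with ∑ i, (v i − v' i)² ≤ ρ², and every measurable set S of functions (Fin R' × Fin n) → ℝ, the composed Gaussian mechanism satisfies M(v)(S) ≤ exp(ε(ρ)) · M(v')(S) + δ. In other words, the R'-fold composed Gaussian mechanism satisfies (ε(ρ), δ)-metric differential privacy under the Euclidean metric at sensitivity ρ. -/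
open MeasureTheory ProbabilityTheory Real

open scoped ENNReal NNReal

section PiDensity

variable {ι : Type*} [Fintype ι] {X : ι → Type*} [∀ i, MeasurableSpace (X i)]
  (μ : ∀ i, Measure (X i)) [∀ i, IsProbabilityMeasure (μ i)]

lemma lintegral_pi_prod_eval {f : ∀ i, X i → ℝ≥0∞} (hf : ∀ i, Measurable (f i)) :
    ∫⁻ x, ∏ i, f i (x i) ∂Measure.pi μ = ∏ i, ∫⁻ y, f i y ∂μ i := by
  refine (lintegral_prod_eq_prod_lintegral_of_indepFun Finset.univ
    (fun i (x : ∀ i, X i) ↦ f i (x i))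
    (iIndepFun_pi fun i ↦ (hf i).aemeasurable)
    (fun i ↦ (hf i).comp (measurable_pi_apply i))).trans ?_
  exact Finset.prod_congr rfl fun i _ ↦ (measurePreserving_eval μ i).lintegral_comp (hf i)

lemma pi_withDensity_eq {f : ∀ i, X i → ℝ≥0∞} (hf : ∀ i, Measurable (f i))
    [∀ i, SigmaFinite ((μ i).withDensity (f i))] :
    Measure.pi (fun i ↦ (μ i).withDensity (f i)) =
      (Measure.pi μ).withDensity fun x ↦ ∏ i, f i (x i) := by
  refine Measure.pi_eq fun s hs ↦ ?_
  have hS : MeasurableSet (Set.univ.pi s) := MeasurableSet.univ_pi hs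
  rw [withDensity_apply _ hS, ← lintegral_indicator hS]
  have h (x : ∀ i, X i) : (Set.univ.pi s).indicator (fun x ↦ ∏ i, f i (x i)) x =
      ∏ i, (s i).indicator (f i) (x i) := by
    by_cases hx : x ∈ Set.univ.pi s
    · rw [Set.indicator_of_mem hx]
      exact Finset.prod_congr rfl fun i _ ↦ (Set.indicator_of_mem (hx i trivial) _).symm
    · rw [Set.indicator_of_notMem hx]
      obtain ⟨i, hi⟩ : ∃ i, x i ∉ s i := by simpa [Set.mem_pi] using hx
      exact (Finset.prod_eq_zero (Finset.mem_univ i) (Set.indicator_of_notMem hi _)).symm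
  simp_rw [h]
  rw [lintegral_pi_prod_eval μ fun i ↦ (hf i).indicator (hs i)]
  exact Finset.prod_congr rfl fun i _ ↦ by
    rw [lintegral_indicator (hs i), withDensity_apply _ (hs i)]

end PiDensity

/-- The log-likelihood ratio of `N(m, s)` with respect to `N(m', s)`. -/
noncomputable def gaussianLogRatio (m m' : ℝ) (s : ℝ≥0) (x : ℝ) : ℝ :=
  (m - m') * (2 * x - m - m') / (2 * s)

@[fun_prop]
lemma measurable_gaussianLogRatio (m m' : ℝ) (s : ℝ≥0) :
    Measurable (gaussianLogRatio m m' s) := by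
  unfold gaussianLogRatio
  fun_prop

lemma gaussianReal_eq_withDensity_gaussianReal (m m' : ℝ) {s : ℝ≥0} (hs : s ≠ 0) :
    gaussianReal m s = (gaussianReal m' s).withDensity
      fun x ↦ ENNReal.ofReal (exp (gaussianLogRatio m m' s x)) := by
  rw [gaussianReal_of_var_ne_zero m hs, gaussianReal_of_var_ne_zero m' hs,
    ← withDensity_mul _ (measurable_gaussianPDF m' s) (by fun_prop)]
  congr 1
  ext x
  have hs' : (s : ℝ) ≠ 0 := by exact_mod_cast hs
  rw [Pi.mul_apply, gaussianPDF, gaussianPDF,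
    ← ENNReal.ofReal_mul (gaussianPDFReal_nonneg _ _ _), gaussianPDFReal, gaussianPDFReal,
    mul_assoc (√_)⁻¹, ← exp_add]
  congr 3
  unfold gaussianLogRatio
  field_simp
  ring

lemma lintegral_exp_mul_gaussianLogRatio (m m' α : ℝ) {s : ℝ≥0} (hs : s ≠ 0) :
    ∫⁻ x, ENNReal.ofReal (exp (α * gaussianLogRatio m m' s x)) ∂gaussianReal m' s =
      ENNReal.ofReal (exp (α * (α - 1) * (m - m') ^ 2 / (2 * s))) := by
  have hs' : (s : ℝ) ≠ 0 := by exact_mod_cast hs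
  have h (x : ℝ) : exp (α * gaussianLogRatio m m' s x) =
      exp (α * (α - 1) * (m - m') ^ 2 / (2 * s)) *
        exp (gaussianLogRatio (m' + α * (m - m')) m' s x) := by
    rw [← exp_add]
    congr 1
    unfold gaussianLogRatio
    field_simp
    ring
  simp_rw [h, ENNReal.ofReal_mul (exp_nonneg _)]
  rw [lintegral_const_mul _ (by fun_prop), ← setLIntegral_univ,
    ← withDensity_apply _ MeasurableSet.univ, ← gaussianReal_eq_withDensity_gaussianReal _ _ hs,
    measure_univ, mul_one]

section GaussianProduct

variable {ι : Type*} [Fintype ι] (m m' : ι → ℝ) {s : ℝ≥0}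

lemma pi_gaussianReal_eq_withDensity (hs : s ≠ 0) :
    Measure.pi (fun i ↦ gaussianReal (m i) s) =
      (Measure.pi fun i ↦ gaussianReal (m' i) s).withDensity
        fun x ↦ ENNReal.ofReal (exp (∑ i, gaussianLogRatio (m i) (m' i) s (x i))) := by
  have h i := gaussianReal_eq_withDensity_gaussianReal (m i) (m' i) hs
  have (i : ι) : SigmaFinite ((gaussianReal (m' i) s).withDensity
      fun x ↦ ENNReal.ofReal (exp (gaussianLogRatio (m i) (m' i) s x))) := by
    rw [← h i]
    infer_instance
  simp_rw [exp_sum, ENNReal.ofReal_prod_of_nonneg fun i _ ↦ exp_nonneg _]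
  rw [← pi_withDensity_eq (fun i ↦ gaussianReal (m' i) s)
    (f := fun i x ↦ ENNReal.ofReal (exp (gaussianLogRatio (m i) (m' i) s x)))
    (fun i ↦ by fun_prop)]
  congr 1
  funext i
  exact h i

lemma lintegral_exp_mul_sum_gaussianLogRatio (α : ℝ) (hs : s ≠ 0) :
    ∫⁻ x, ENNReal.ofReal (exp (α * ∑ i, gaussianLogRatio (m i) (m' i) s (x i)))
        ∂Measure.pi (fun i ↦ gaussianReal (m' i) s) =
      ENNReal.ofReal (exp (α * (α - 1) * (∑ i, (m i - m' i) ^ 2) / (2 * s))) := by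
  simp_rw [Finset.mul_sum, Finset.sum_div, exp_sum,
    ENNReal.ofReal_prod_of_nonneg fun i _ ↦ exp_nonneg _]
  rw [lintegral_pi_prod_eval (fun i ↦ gaussianReal (m' i) s)
    (f := fun i x ↦ ENNReal.ofReal (exp (α * gaussianLogRatio (m i) (m' i) s x)))
    (fun i ↦ by fun_prop)]
  simp_rw [lintegral_exp_mul_gaussianLogRatio _ _ α hs]

end GaussianProduct

lemma exp_le_exp_add_exp {α : ℝ} (hα : 1 < α) (u ε : ℝ) :
    exp u ≤ exp ε + exp (α * u + (α - 1) * (log ((α - 1) / α) - ε) - log α) := by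
  have hα0 : 0 < α := by linarith
  have hα1 : 0 < α - 1 := by linarith
  set l := log ((α - 1) / α) with hl
  have hexp : exp l = (α - 1) / α := exp_log (by positivity)
  set z := u - ε + l with hz
  have h₁ : exp ε = exp u * ((α - 1) / α * exp (-z)) := by
    rw [← hexp, ← exp_add, ← exp_add]
    congr 1
    ring
  have h₂ : exp (α * u + (α - 1) * (l - ε) - log α) =
      exp u * (1 / α * exp ((α - 1) * z)) := by
    rw [one_div, ← exp_log (inv_pos.2 hα0), log_inv, ← exp_add, ← exp_add]
    congr 1
    ring
  rw [h₁, h₂, ← mul_add]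
  refine le_mul_of_one_le_right (exp_nonneg _) ?_
  calc (1 : ℝ) = (α - 1) / α * (-z + 1) + 1 / α * ((α - 1) * z + 1) := by field_simp; ring
    _ ≤ _ := by gcongr <;> exact add_one_le_exp _

/-- Conversion of a Rényi divergence bound into approximate indistinguishability. -/
lemma withDensity_exp_apply_le {Ω : Type*} [MeasurableSpace Ω] {μ : Measure Ω}
    {U : Ω → ℝ} (hU : Measurable U) {α r δ : ℝ} (hα : 1 < α) (hδ : 0 < δ)
    (h : ∫⁻ x, ENNReal.ofReal (exp (α * U x)) ∂μ ≤ ENNReal.ofReal (exp ((α - 1) * r)))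
    {S : Set Ω} (hS : MeasurableSet S) :
    μ.withDensity (fun x ↦ ENNReal.ofReal (exp (U x))) S ≤
      ENNReal.ofReal (exp (r + log ((α - 1) / α) - log (δ * α) / (α - 1))) * μ S
        + ENNReal.ofReal δ := by
  have hα0 : 0 < α := by linarith
  have hα1 : 0 < α - 1 := by linarith
  set ε := r + log ((α - 1) / α) - log (δ * α) / (α - 1) with hε
  set K := (α - 1) * (log ((α - 1) / α) - ε) - log α with hK
  have hKδ : (α - 1) * r + K = log δ := by
    rw [hK, hε, log_mul hδ.ne' hα0.ne']
    field_simp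
    ring
  have hpt (x : Ω) : ENNReal.ofReal (exp (U x)) ≤
      ENNReal.ofReal (exp ε) + ENNReal.ofReal (exp (α * U x)) * ENNReal.ofReal (exp K) := by
    rw [← ENNReal.ofReal_mul (exp_nonneg _), ← ENNReal.ofReal_add (exp_nonneg _) (by positivity),
      ← exp_add, hK, ← add_sub_assoc]
    exact ENNReal.ofReal_le_ofReal (exp_le_exp_add_exp hα _ _)
  rw [withDensity_apply _ hS]
  calc ∫⁻ x in S, ENNReal.ofReal (exp (U x)) ∂μ
      ≤ ∫⁻ x in S, (ENNReal.ofReal (exp ε)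
          + ENNReal.ofReal (exp (α * U x)) * ENNReal.ofReal (exp K)) ∂μ := lintegral_mono hpt
    _ = ENNReal.ofReal (exp ε) * μ S
          + (∫⁻ x in S, ENNReal.ofReal (exp (α * U x)) ∂μ) * ENNReal.ofReal (exp K) := by
        rw [lintegral_add_left measurable_const, setLIntegral_const,
          lintegral_mul_const _ (by fun_prop)]
    _ ≤ ENNReal.ofReal (exp ε) * μ S
          + ENNReal.ofReal (exp ((α - 1) * r)) * ENNReal.ofReal (exp K) := by
        gcongr
        exact (setLIntegral_le_lintegral _ _).trans h
    _ = _ := by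
        rw [← ENNReal.ofReal_mul (exp_nonneg _), ← exp_add, hKδ, exp_log hδ]

lemma log_neg_log_add_log_le {α δ : ℝ} (hα : 1 < α) (hδ0 : 0 < δ) (hδ1 : δ < 1) :
    log (-log δ) + log δ ≤ log ((α - 1) / α) - log (δ * α) / (α - 1) := by
  have hα0 : 0 < α := by linarith
  have hα1 : 0 < α - 1 := by linarith
  have hd : 0 < -log δ := neg_pos.2 (log_neg hδ0 hδ1)
  have h₁ : log α / (α - 1) ≤ 1 := (div_le_one hα1).2 (log_le_sub_one_of_pos hα0)
  have h₂ := log_le_sub_one_of_pos (show 0 < -log δ * (α / (α - 1)) by positivity)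
  rw [log_mul hd.ne' (by positivity), ← inv_div, log_inv] at h₂
  have h₃ : α / (α - 1) = 1 + 1 / (α - 1) := by field_simp; ring
  rw [inv_div, h₃] at h₂
  rw [log_mul hδ0.ne' hα0.ne', add_div]
  have h₄ : -log δ * (1 + 1 / (α - 1)) = -log δ - log δ / (α - 1) := by ring
  linarith

theorem composed_gaussian_metric_dp
    (n R' : ℕ) (hn : 1 ≤ n) (hR : 1 ≤ R')
    (σ₀ δ ρ : ℝ) (hσ : 0 < σ₀) (hδ0 : 0 < δ) (hδ1 : δ < 1) (hρ : 0 < ρ)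
    (ε : ℝ)
    (hε : ε = sInf {x : ℝ | ∃ α : ℝ, 1 < α ∧
      x = (R' : ℝ) * α * ρ ^ 2 / (2 * σ₀ ^ 2)
          + Real.log ((α - 1) / α) - Real.log (δ * α) / (α - 1)}) :
    ∀ v v' : Fin n → ℝ, (∑ i, (v i - v' i) ^ 2 ≤ ρ ^ 2) →
      ∀ S : Set ((Fin R' × Fin n) → ℝ), MeasurableSet S →
        composedGaussian R' n σ₀ v S ≤
          ENNReal.ofReal (Real.exp ε) * composedGaussian R' n σ₀ v' S
            + ENNReal.ofReal δ := by
  intro v v' hvv S hS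
  have hs : Real.toNNReal (σ₀ ^ 2) ≠ 0 := (Real.toNNReal_pos.2 (by positivity)).ne'
  have hfin : composedGaussian R' n σ₀ v' S ≠ ∞ := by
    unfold composedGaussian
    exact measure_ne_top _ _
  have hclosed : IsClosed {x : ℝ | composedGaussian R' n σ₀ v S ≤
      ENNReal.ofReal (exp x) * composedGaussian R' n σ₀ v' S + ENNReal.ofReal δ} :=
    isClosed_le continuous_const (((ENNReal.continuous_mul_const hfin).comp
      (ENNReal.continuous_ofReal.comp continuous_exp)).add continuous_const)
  rw [hε]
  refine closure_minimal ?_ hclosed (csInf_mem_closure ⟨_, 2, one_lt_two, rfl⟩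
    ⟨log (-log δ) + log δ, ?_⟩)
  · rintro _ ⟨α, hα, rfl⟩
    rw [Set.mem_ofPred_eq]
    unfold composedGaussian
    rw [pi_gaussianReal_eq_withDensity (fun p : Fin R' × Fin n ↦ v p.2) (fun p ↦ v' p.2) hs]
    refine withDensity_exp_apply_le (by fun_prop) hα hδ0 ?_ hS
    rw [lintegral_exp_mul_sum_gaussianLogRatio (fun p : Fin R' × Fin n ↦ v p.2)
      (fun p ↦ v' p.2) α hs, Real.coe_toNNReal _ (by positivity)]
    refine ENNReal.ofReal_le_ofReal (exp_le_exp.2 ?_)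
    have hsum : ∑ p : Fin R' × Fin n, (v p.2 - v' p.2) ^ 2 = R' * ∑ i, (v i - v' i) ^ 2 := by
      simp [Fintype.sum_prod_type]
    have hα1 : 0 < α - 1 := by linarith
    rw [hsum]
    calc α * (α - 1) * (R' * ∑ i, (v i - v' i) ^ 2) / (2 * σ₀ ^ 2)
        ≤ α * (α - 1) * (R' * ρ ^ 2) / (2 * σ₀ ^ 2) := by gcongr
      _ = _ := by ring
  · rintro _ ⟨α, hα, rfl⟩
    have h₁ := log_neg_log_add_log_le hα hδ0 hδ1
    have h₂ : 0 ≤ (R' : ℝ) * α * ρ ^ 2 / (2 * σ₀ ^ 2) := by positivity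
    linarith
end

section
/- Let n ≥ 1, R' ≥ 1 be natural numbers, σ₀ > 0 and δ ∈ (0,1). For all L₂-normalized vectors v, v' : Fin n → ℝ (i.e., ∑ i, (v i)² = 1 and ∑ i, (v' i)² = 1) and every measurable set S of functions (Fin R' × Fin n) → ℝ, the composed Gaussian mechanism satisfies M(v)(S) ≤ exp(ε) · M(v')(S) + δ, where ε = inf over α ∈ (1,∞) of [ 2·R'·α/σ₀² + log((α−1)/α) − log(δ·α)/(α−1) ]. That is, on unit-norm inputs the mechanism satisfies standard (ε,δ)-differential privacy, recovering the metric-DP guarantee with ρ equal to the diameter 2 of the unit L₂ sphere. -/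
open MeasureTheory ProbabilityTheory Real

/-- A finite product of nondegenerate real Gaussian measures has the product of the Gaussian
densities as its density with respect to Lebesgue measure. -/
lemma pi_gaussianReal_eq_withDensity_s2 {ι : Type*} [Fintype ι] (m : ι → ℝ) {s : NNReal}
    (hs : s ≠ 0) :
    Measure.pi (fun i => gaussianReal (m i) s) =
      (volume : Measure (ι → ℝ)).withDensity
        (fun x => ENNReal.ofReal (∏ i, gaussianPDFReal (m i) s (x i))) := by
  refine Measure.pi_eq fun t ht => ?_
  rw [withDensity_apply _ (MeasurableSet.univ_pi ht), volume_pi, Measure.restrict_pi_pi,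
    ← ofReal_integral_eq_lintegral_ofReal
      (Integrable.fintype_prod fun i => (integrable_gaussianPDFReal (m i) s).restrict)
      (ae_of_all _ fun x => Finset.prod_nonneg fun i _ => gaussianPDFReal_nonneg _ _ _),
    integral_fintype_prod_eq_prod (fun i => gaussianPDFReal (m i) s),
    ENNReal.ofReal_prod_of_nonneg
      fun i _ => integral_nonneg fun x => gaussianPDFReal_nonneg _ _ _]
  exact Finset.prod_congr rfl fun i _ => (gaussianReal_apply_eq_integral (m i) hs (t i)).symm

lemma prod_gaussianPDFReal {ι : Type*} [Fintype ι] (m : ι → ℝ) (s : NNReal) (x : ι → ℝ) :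
    ∏ i, gaussianPDFReal (m i) s (x i) =
      (√(2 * π * s))⁻¹ ^ Fintype.card ι * exp (-∑ i, (x i - m i) ^ 2 / (2 * s)) := by
  simp [gaussianPDFReal, Finset.prod_mul_distrib, ← exp_sum, neg_div, Finset.sum_neg_distrib]

/-- The privacy parameter `ε` obtained from Rényi divergence at most `ρ` at order `α`. -/
noncomputable def renyiEpsilon (α δ ρ : ℝ) : ℝ :=
  ρ + log ((α - 1) / α) - log (δ * α) / (α - 1)

lemma exp_neg_le_exp_renyiEpsilon {α δ ρ a b d : ℝ} (hα : 1 < α) (hδ : 0 < δ)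
    (hd : α * d ≤ ρ) :
    exp (-a) ≤ exp (renyiEpsilon α δ ρ) * exp (-b)
      + δ * exp (-(α * a + (1 - α) * b + α * (α - 1) * d)) := by
  have hα0 : 0 < α := by linarith
  have hα1 : 0 < α - 1 := by linarith
  set ε := renyiEpsilon α δ ρ with hε
  set c := α * a + (1 - α) * b + α * (α - 1) * d with hc
  set A := ε - log ((α - 1) / α) + a - b with hA
  set B := log (δ * α) + a - c with hB
  have hAB : 0 ≤ (α - 1) * A + B := by
    have : (α - 1) * A + B = (α - 1) * (ρ - α * d) := by
      rw [hA, hB, hc, hε, renyiEpsilon]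
      field_simp
      ring
    rw [this]
    exact mul_nonneg hα1.le (by linarith)
  have hA1 : exp ε * exp (-b) = (α - 1) / α * exp A * exp (-a) := by
    have h : (α - 1) / α = exp (log ((α - 1) / α)) := (exp_log (by positivity)).symm
    rw [h, ← exp_add, ← exp_add, ← exp_add]
    congr 1
    rw [hA]
    ring
  have hB1 : δ * exp (-c) = 1 / α * exp B * exp (-a) := by
    have h : δ = 1 / α * exp (log (δ * α)) := by
      rw [exp_log (by positivity)]
      field_simp
    rw [hB, show log (δ * α) + a - c = log (δ * α) + (a - c) by ring, exp_add, ← mul_assoc, ← h,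
      mul_assoc, ← exp_add]
    congr 2
    ring
  have hone : 1 ≤ (α - 1) / α * exp A + 1 / α * exp B := by
    have h : (α - 1) / α * exp A + 1 / α * exp B = ((α - 1) * exp A + exp B) / α := by ring
    rw [h, le_div_iff₀ hα0]
    nlinarith [mul_le_mul_of_nonneg_left (add_one_le_exp A) hα1.le, add_one_le_exp B]
  rw [hA1, hB1, ← add_mul]
  exact le_mul_of_one_le_left (exp_pos _).le hone

/-- The densities of two Gaussian products are compared, up to the factor `exp ε` and an additive
error `δ`, using the Gaussian density proportional to the geometric mixture of order `α`. -/
lemma prod_gaussianPDFReal_le {ι : Type*} [Fintype ι] (m m' : ι → ℝ) {s : NNReal} {α δ ρ : ℝ}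
    (hs : s ≠ 0) (hα : 1 < α) (hδ : 0 < δ)
    (hρ : α * ∑ i, (m i - m' i) ^ 2 / (2 * s) ≤ ρ) (x : ι → ℝ) :
    ∏ i, gaussianPDFReal (m i) s (x i) ≤
      exp (renyiEpsilon α δ ρ) * ∏ i, gaussianPDFReal (m' i) s (x i)
        + δ * ∏ i, gaussianPDFReal (α * m i + (1 - α) * m' i) s (x i) := by
  have hs0 : (s : ℝ) ≠ 0 := by exact_mod_cast hs
  have hc : ∑ i, (x i - (α * m i + (1 - α) * m' i)) ^ 2 / (2 * s) =
      α * ∑ i, (x i - m i) ^ 2 / (2 * s) + (1 - α) * ∑ i, (x i - m' i) ^ 2 / (2 * s)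
        + α * (α - 1) * ∑ i, (m i - m' i) ^ 2 / (2 * s) := by
    simp only [Finset.mul_sum, ← Finset.sum_add_distrib]
    refine Finset.sum_congr rfl fun i _ => ?_
    field_simp
    ring
  rw [prod_gaussianPDFReal, prod_gaussianPDFReal, prod_gaussianPDFReal, hc]
  refine (mul_le_mul_of_nonneg_left (exp_neg_le_exp_renyiEpsilon
    (b := ∑ i, (x i - m' i) ^ 2 / (2 * s)) hα hδ hρ)
    (by positivity)).trans_eq ?_
  ring

lemma pi_gaussianReal_le {ι : Type*} [Fintype ι] (m m' : ι → ℝ) {s : NNReal} {α δ ρ : ℝ}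
    (hs : s ≠ 0) (hα : 1 < α) (hδ : 0 < δ)
    (hρ : α * ∑ i, (m i - m' i) ^ 2 / (2 * s) ≤ ρ) {S : Set (ι → ℝ)} (hS : MeasurableSet S) :
    Measure.pi (fun i => gaussianReal (m i) s) S ≤
      ENNReal.ofReal (exp (renyiEpsilon α δ ρ)) * Measure.pi (fun i => gaussianReal (m' i) s) S
        + ENNReal.ofReal δ := by
  have hmeas (k : ι → ℝ) :
      Measurable fun x : ι → ℝ => ENNReal.ofReal (∏ i, gaussianPDFReal (k i) s (x i)) := by
    fun_prop
  have happly (k : ι → ℝ) : Measure.pi (fun i => gaussianReal (k i) s) S =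
      ∫⁻ x in S, ENNReal.ofReal (∏ i, gaussianPDFReal (k i) s (x i)) := by
    rw [pi_gaussianReal_eq_withDensity_s2 k hs, withDensity_apply _ hS]
  calc Measure.pi (fun i => gaussianReal (m i) s) S
      ≤ ENNReal.ofReal (exp (renyiEpsilon α δ ρ)) *
            Measure.pi (fun i => gaussianReal (m' i) s) S
          + ENNReal.ofReal δ *
            Measure.pi (fun i => gaussianReal (α * m i + (1 - α) * m' i) s) S := by
        rw [happly m, happly m', happly fun i => α * m i + (1 - α) * m' i,
          ← lintegral_const_mul _ (hmeas _), ← lintegral_const_mul _ (hmeas _),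
          ← lintegral_add_left ((hmeas _).const_mul _)]
        refine lintegral_mono fun x => ?_
        rw [← ENNReal.ofReal_mul (exp_pos _).le, ← ENNReal.ofReal_mul hδ.le]
        exact (ENNReal.ofReal_le_ofReal (prod_gaussianPDFReal_le m m' hs hα hδ hρ x)).trans
          ENNReal.ofReal_add_le
    _ ≤ _ := by
        gcongr
        exact mul_le_of_le_one_right' prob_le_one

lemma sum_sub_sq_le_four {ι : Type*} [Fintype ι] {v v' : ι → ℝ} (hv : ∑ i, (v i) ^ 2 = 1)
    (hv' : ∑ i, (v' i) ^ 2 = 1) : ∑ i, (v i - v' i) ^ 2 ≤ 4 := by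
  calc ∑ i, (v i - v' i) ^ 2 ≤ ∑ i, (2 * v i ^ 2 + 2 * v' i ^ 2) :=
        Finset.sum_le_sum fun i _ => by nlinarith [sq_nonneg (v i + v' i)]
    _ = 4 := by rw [Finset.sum_add_distrib, ← Finset.mul_sum, ← Finset.mul_sum, hv, hv']; norm_num

lemma composedGaussian_le {n R' : ℕ} {σ₀ α δ : ℝ} (hσ : 0 < σ₀) (hα : 1 < α) (hδ : 0 < δ)
    {v v' : Fin n → ℝ} (hv : ∑ i, (v i) ^ 2 = 1) (hv' : ∑ i, (v' i) ^ 2 = 1)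
    {S : Set ((Fin R' × Fin n) → ℝ)} (hS : MeasurableSet S) :
    composedGaussian R' n σ₀ v S ≤
      ENNReal.ofReal (exp (renyiEpsilon α δ (2 * R' * α / σ₀ ^ 2))) *
        composedGaussian R' n σ₀ v' S + ENNReal.ofReal δ := by
  refine pi_gaussianReal_le (fun p : Fin R' × Fin n => v p.2) (fun p => v' p.2)
    (by simpa using hσ.ne') hα hδ ?_ hS
  rw [coe_toNNReal _ (sq_nonneg σ₀), ← Finset.sum_div, Fintype.sum_prod_type]
  simp only [Finset.sum_const, Finset.card_univ, Fintype.card_fin, nsmul_eq_mul]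
  calc α * (R' * (∑ i, (v i - v' i) ^ 2) / (2 * σ₀ ^ 2))
      ≤ α * (R' * 4 / (2 * σ₀ ^ 2)) := by
        have := sum_sub_sq_le_four hv hv'
        gcongr
    _ = 2 * R' * α / σ₀ ^ 2 := by ring

theorem composed_gaussian_standard_dp_on_unit_sphere
    (n R' : ℕ) (hn : 1 ≤ n) (hR : 1 ≤ R')
    (σ₀ δ : ℝ) (hσ : 0 < σ₀) (hδ0 : 0 < δ) (hδ1 : δ < 1) :
    ∀ v v' : Fin n → ℝ, (∑ i, (v i) ^ 2 = 1) → (∑ i, (v' i) ^ 2 = 1) →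
      ∀ S : Set ((Fin R' × Fin n) → ℝ), MeasurableSet S →
        composedGaussian R' n σ₀ v S ≤
          ENNReal.ofReal (Real.exp (sInf {x : ℝ | ∃ α : ℝ, 1 < α ∧
              x = 2 * (R' : ℝ) * α / σ₀ ^ 2
                + Real.log ((α - 1) / α) - Real.log (δ * α) / (α - 1)})) *
            composedGaussian R' n σ₀ v' S + ENNReal.ofReal δ := by
  intro v v' hv hv' S hS
  set E := {x : ℝ | ∃ α : ℝ, 1 < α ∧ x = 2 * (R' : ℝ) * α / σ₀ ^ 2
    + Real.log ((α - 1) / α) - Real.log (δ * α) / (α - 1)}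
  have hprob (w : Fin n → ℝ) : IsProbabilityMeasure (composedGaussian R' n σ₀ w) := by
    unfold composedGaussian
    infer_instance
  have hle : ∀ T : Set ((Fin R' × Fin n) → ℝ), MeasurableSet T → ∀ x ∈ E,
      (composedGaussian R' n σ₀ v).real T ≤
        exp x * (composedGaussian R' n σ₀ v').real T + δ := by
    rintro T hT x ⟨α, hα, rfl⟩
    refine ENNReal.toReal_le_of_le_ofReal (by positivity)
      ((composedGaussian_le hσ hα hδ0 hv hv' hT).trans_eq ?_)
    rw [ENNReal.ofReal_add (by positivity) hδ0.le, ENNReal.ofReal_mul (exp_pos _).le,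
      ofReal_measureReal]
    rfl
  have hbdd : BddBelow E := by
    refine ⟨log (1 - δ), fun x hx => ?_⟩
    have := hle Set.univ MeasurableSet.univ x hx
    simp only [probReal_univ, mul_one] at this
    exact (log_le_iff_le_exp (by linarith)).2 (by linarith)
  have hclosed : IsClosed {x : ℝ | (composedGaussian R' n σ₀ v).real S ≤
      exp x * (composedGaussian R' n σ₀ v').real S + δ} :=
    isClosed_le (by fun_prop) (by fun_prop)
  have hmem : sInf E ∈ {x : ℝ | (composedGaussian R' n σ₀ v).real S ≤
      exp x * (composedGaussian R' n σ₀ v').real S + δ} :=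
    closure_minimal (hle S hS) hclosed (csInf_mem_closure ⟨_, 2, one_lt_two, rfl⟩ hbdd)
  rw [← ofReal_measureReal (μ := composedGaussian R' n σ₀ v),
    ← ofReal_measureReal (μ := composedGaussian R' n σ₀ v'),
    ← ENNReal.ofReal_mul (exp_pos _).le, ← ENNReal.ofReal_add (by positivity) hδ0.le]
  exact ENNReal.ofReal_le_ofReal hmem
end

section
/- For all real μ, μ', all σ > 0, and every real α, the function t ↦ (gaussianPDFReal μ σ² t)^α · (gaussianPDFReal μ' σ² t)^(1−α) is integrable with respect to Lebesgue measure on ℝ and ∫ (gaussianPDFReal μ σ² t)^α · (gaussianPDFReal μ' σ² t)^(1−α) dt = exp( α·(α−1)·(μ−μ')²/(2σ²) ). Equivalently, the Rényi divergence of order α between two Gaussians with common variance σ² and means μ, μ' equals α·(μ−μ')²/(2σ²). -/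
open MeasureTheory ProbabilityTheory Real

/-- A weighted geometric mean of two Gaussian densities with common variance is a multiple of the
Gaussian density with the weighted mean. -/
lemma gaussianPDFReal_rpow_mul_rpow_one_sub (m₁ m₂ α : ℝ) {v : NNReal} (hv : v ≠ 0) (t : ℝ) :
    gaussianPDFReal m₁ v t ^ α * gaussianPDFReal m₂ v t ^ (1 - α) =
      exp (α * (α - 1) * (m₁ - m₂) ^ 2 / (2 * v)) *
        gaussianPDFReal (α * m₁ + (1 - α) * m₂) v t := by
  have hv' : (0 : ℝ) < v := by positivity
  have hc : 0 < (√(2 * π * v))⁻¹ := by positivity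
  simp only [gaussianPDFReal]
  generalize (√(2 * π * v))⁻¹ = c at hc ⊢
  rw [mul_rpow hc.le (exp_pos _).le, mul_rpow hc.le (exp_pos _).le, mul_mul_mul_comm,
    ← rpow_add hc, add_sub_cancel, rpow_one, ← exp_mul, ← exp_mul, ← exp_add,
    mul_left_comm, ← exp_add]
  congr 2
  field_simp
  ring

theorem renyi_divergence_gaussians_common_variance
    (μ μ' σ α : ℝ) (hσ : 0 < σ) :
    Integrable (fun t : ℝ =>
        gaussianPDFReal μ (Real.toNNReal (σ ^ 2)) t ^ α *
          gaussianPDFReal μ' (Real.toNNReal (σ ^ 2)) t ^ (1 - α)) volume ∧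
    ∫ t : ℝ, gaussianPDFReal μ (Real.toNNReal (σ ^ 2)) t ^ α *
        gaussianPDFReal μ' (Real.toNNReal (σ ^ 2)) t ^ (1 - α)
      = Real.exp (α * (α - 1) * (μ - μ') ^ 2 / (2 * σ ^ 2)) := by
  have hv : Real.toNNReal (σ ^ 2) ≠ 0 := by simpa using hσ.ne'
  simp only [gaussianPDFReal_rpow_mul_rpow_one_sub _ _ _ hv, Real.coe_toNNReal _ (sq_nonneg σ)]
  exact ⟨(integrable_gaussianPDFReal _ _).const_mul _, by
    rw [integral_const_mul, integral_gaussianPDFReal_eq_one _ hv, mul_one]⟩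
end

section
/- Let n ≥ 1, σ > 0, α ∈ ℝ, and μ, μ' : Fin n → ℝ. With Q the product measure on Fin n → ℝ whose i-th coordinate is the Gaussian measure with mean μ' i and variance σ², the likelihood-ratio moment satisfies ∫ ∏ i, ( gaussianPDFReal (μ i) σ² (x i) / gaussianPDFReal (μ' i) σ² (x i) )^α dQ(x) = exp( α·(α−1)·(∑ i, (μ i − μ' i)²)/(2σ²) ). Equivalently, the Rényi divergence of order α between two spherical Gaussians on ℝⁿ with equal covariance σ² I and means μ, μ' equals α·‖μ−μ'‖²/(2σ²). -/
open MeasureTheory ProbabilityTheory Real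

lemma gaussianPDFReal_div_gaussianPDFReal (a b x : ℝ) {v : NNReal} (hv : v ≠ 0) :
    gaussianPDFReal a v x / gaussianPDFReal b v x
      = exp (((x - b) ^ 2 - (x - a) ^ 2) / (2 * v)) := by
  have hv' : (0 : ℝ) < v := NNReal.coe_pos.mpr (pos_iff_ne_zero.mpr hv)
  have hs : (√(2 * π * v))⁻¹ ≠ 0 := by positivity
  rw [gaussianPDFReal_def, gaussianPDFReal_def, mul_div_mul_left _ _ hs, ← exp_sub]
  congr 1
  ring

lemma gaussianPDFReal_mul_rpow_div (a b α x : ℝ) {v : NNReal} (hv : v ≠ 0) :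
    gaussianPDFReal b v x * (gaussianPDFReal a v x / gaussianPDFReal b v x) ^ α
      = exp (α * (α - 1) * (a - b) ^ 2 / (2 * v))
        * gaussianPDFReal (b + α * (a - b)) v x := by
  have hv' : (v : ℝ) ≠ 0 := NNReal.coe_ne_zero.mpr hv
  rw [gaussianPDFReal_div_gaussianPDFReal a b x hv, ← exp_mul, gaussianPDFReal_def,
    gaussianPDFReal_def, mul_assoc, ← exp_add, mul_left_comm, ← exp_add]
  congr 2
  field_simp
  ring

lemma integral_rpow_gaussianPDFReal_div (a b α : ℝ) {v : NNReal} (hv : v ≠ 0) :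
    ∫ x, (gaussianPDFReal a v x / gaussianPDFReal b v x) ^ α ∂gaussianReal b v
      = exp (α * (α - 1) * (a - b) ^ 2 / (2 * v)) := by
  simp_rw [integral_gaussianReal_eq_integral_smul hv, smul_eq_mul,
    gaussianPDFReal_mul_rpow_div a b α _ hv]
  rw [integral_const_mul, integral_gaussianPDFReal_eq_one _ hv, mul_one]

theorem renyi_divergence_spherical_gaussians
    (n : ℕ) (hn : 1 ≤ n) (σ α : ℝ) (hσ : 0 < σ) (μ μ' : Fin n → ℝ) :
    ∫ x : Fin n → ℝ,
        (∏ i, (gaussianPDFReal (μ i) (Real.toNNReal (σ ^ 2)) (x i) /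
            gaussianPDFReal (μ' i) (Real.toNNReal (σ ^ 2)) (x i)) ^ α)
        ∂(Measure.pi fun i => gaussianReal (μ' i) (Real.toNNReal (σ ^ 2)))
      = Real.exp (α * (α - 1) * (∑ i, (μ i - μ' i) ^ 2) / (2 * σ ^ 2)) := by
  have hv : Real.toNNReal (σ ^ 2) ≠ 0 := (Real.toNNReal_pos.mpr (by positivity)).ne'
  rw [integral_fintype_prod_eq_prod (f := fun i (y : ℝ) =>
    (gaussianPDFReal (μ i) (Real.toNNReal (σ ^ 2)) y /
      gaussianPDFReal (μ' i) (Real.toNNReal (σ ^ 2)) y) ^ α)]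
  simp_rw [integral_rpow_gaussianPDFReal_div _ _ α hv, Real.coe_toNNReal _ (sq_nonneg σ)]
  rw [← exp_sum, Finset.mul_sum, Finset.sum_div]
end

section
/- Let n ≥ 1, R' ≥ 1, σ₀ > 0, α ∈ ℝ, and μ, μ' : Fin n → ℝ. Let M(μ) be the composed Gaussian mechanism. Then the α-th likelihood-ratio moment of the composition factorizes over rounds: ∫ ∏_{(r,i)}, ( gaussianPDFReal (μ i) σ₀² (x (r,i)) / gaussianPDFReal (μ' i) σ₀² (x (r,i)) )^α dM(μ')(x) = exp( R'·α·(α−1)·(∑ i, (μ i − μ' i)²)/(2σ₀²) ). Equivalently, the Rényi divergence of order α composes additively over the R' rounds, giving R'·α·‖μ−μ'‖²/(2σ₀²). -/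
open MeasureTheory ProbabilityTheory Real

/-- The moment of order `α` of the likelihood ratio of two Gaussians with the same variance. -/
theorem integral_gaussianPDFReal_div_rpow (m m' α : ℝ) {v : NNReal} (hv : v ≠ 0) :
    ∫ x, (gaussianPDFReal m v x / gaussianPDFReal m' v x) ^ α ∂(gaussianReal m' v)
      = Real.exp (α * (α - 1) * (m - m') ^ 2 / (2 * v)) := by
  have hv' : (v : ℝ) ≠ 0 := NNReal.coe_ne_zero.mpr hv
  have ratio (x : ℝ) : (gaussianPDFReal m v x / gaussianPDFReal m' v x) ^ α
      = Real.exp (α * (m - m') / v * x) * Real.exp (α * (m' ^ 2 - m ^ 2) / (2 * v)) := by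
    have hc : (√(2 * π * v))⁻¹ ≠ 0 := by positivity
    rw [gaussianPDFReal, gaussianPDFReal, mul_div_mul_left _ _ hc, ← Real.exp_sub,
      ← Real.exp_mul, ← Real.exp_add]
    congr 1
    field_simp
    ring
  have hmgf := mgf_gaussianReal (p := gaussianReal m' v) (X := id) Measure.map_id
    (α * (m - m') / v)
  simp only [mgf, id] at hmgf
  simp_rw [ratio]
  rw [integral_mul_const, hmgf, ← Real.exp_add]
  congr 1
  field_simp
  ring

theorem renyi_divergence_composed_gaussian_mechanism
    (n R' : ℕ) (hn : 1 ≤ n) (hR : 1 ≤ R')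
    (σ₀ α : ℝ) (hσ : 0 < σ₀) (μ μ' : Fin n → ℝ) :
    ∫ x : (Fin R' × Fin n) → ℝ,
        (∏ p : Fin R' × Fin n,
          (gaussianPDFReal (μ p.2) (Real.toNNReal (σ₀ ^ 2)) (x p) /
            gaussianPDFReal (μ' p.2) (Real.toNNReal (σ₀ ^ 2)) (x p)) ^ α)
        ∂(composedGaussian R' n σ₀ μ')
      = Real.exp ((R' : ℝ) * α * (α - 1) * (∑ i, (μ i - μ' i) ^ 2) / (2 * σ₀ ^ 2)) := by
  have hv : Real.toNNReal (σ₀ ^ 2) ≠ 0 := by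
    simpa using hσ.ne'
  rw [composedGaussian, integral_fintype_prod_eq_prod (f := fun (p : Fin R' × Fin n) (y : ℝ) =>
    (gaussianPDFReal (μ p.2) (Real.toNNReal (σ₀ ^ 2)) y /
      gaussianPDFReal (μ' p.2) (Real.toNNReal (σ₀ ^ 2)) y) ^ α)]
  simp_rw [integral_gaussianPDFReal_div_rpow _ _ α hv]
  rw [← Real.exp_sum, Real.coe_toNNReal _ (sq_nonneg σ₀), Fintype.sum_prod_type]
  simp only [Finset.sum_const, Finset.card_univ, Fintype.card_fin, nsmul_eq_mul,
    ← Finset.sum_div, ← Finset.mul_sum]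
  congr 1
  ring
end

section
/- Let E be a real inner product space, F : E → ℝ differentiable with C₁-Lipschitz gradient (C₁ > 0) and bounded below by F*. Let η > 0 satisfy η·C₁ ≤ 1/4, let G : ℕ → E be any sequence of vectors, and let w : ℕ → E satisfy w(k) = w(k−1) − η·G(k) for k ≥ 1. Then for every T ≥ 1: (1/T)·∑_{k=1}^{T} ‖∇F(w(k−1))‖² ≤ 4·(F(w(0)) − F*)/(η·T) + (4/T)·∑_{k=1}^{T} ‖G(k) − ∇F(w(k−1))‖². -/
/-- The quadratic upper bound satisfied by a function with Lipschitz gradient. -/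
theorem le_quadratic_of_lipschitz_gradient
    {E : Type*} [NormedAddCommGroup E] [InnerProductSpace ℝ E] [CompleteSpace E]
    {F : E → ℝ} {C : ℝ} (hF : Differentiable ℝ F)
    (hLip : ∀ x y, ‖gradient F x - gradient F y‖ ≤ C * ‖x - y‖) (x v : E) :
    F (x + v) ≤ F x + inner ℝ (gradient F x) v + C / 2 * ‖v‖ ^ 2 := by
  let φ : ℝ → ℝ := fun t ↦
    F (x + t • v) - (t * inner ℝ (gradient F x) v + C / 2 * ‖v‖ ^ 2 * t ^ 2)
  have hφ (t : ℝ) : HasDerivAt φ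
      (inner ℝ (gradient F (x + t • v)) v
        - (inner ℝ (gradient F x) v + C * ‖v‖ ^ 2 * t)) t := by
    have hline : HasDerivAt (fun s : ℝ ↦ x + s • v) v t := by
      simpa using ((hasDerivAt_id t).smul_const v).const_add x
    have hcomp := (hF (x + t • v)).hasGradientAt.hasFDerivAt.comp_hasDerivAt t hline
    have hquad := ((hasDerivAt_id t).mul_const (inner ℝ (gradient F x) v)).add
      (((hasDerivAt_id t).pow 2).const_mul (C / 2 * ‖v‖ ^ 2))
    convert! hcomp.sub hquad using 1
    simp
    ring
  have hanti : AntitoneOn φ (Set.Icc 0 1) := by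
    refine antitoneOn_of_hasDerivWithinAt_nonpos (convex_Icc 0 1)
      (fun t _ ↦ (hφ t).continuousAt.continuousWithinAt)
      (fun t _ ↦ (hφ t).hasDerivWithinAt) fun t ht ↦ ?_
    rw [interior_Icc] at ht
    have hgrad := hLip (x + t • v) x
    rw [add_sub_cancel_left, norm_smul, Real.norm_of_nonneg ht.1.le] at hgrad
    have hinner := real_inner_le_norm (gradient F (x + t • v) - gradient F x) v
    rw [inner_sub_left] at hinner
    linarith [mul_le_mul_of_nonneg_right hgrad (norm_nonneg v)]
  have h01 := hanti (Set.left_mem_Icc.2 zero_le_one) (Set.right_mem_Icc.2 zero_le_one)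
    zero_le_one
  simp only [φ, one_smul, zero_smul, add_zero] at h01
  linarith

/-- One step of gradient descent with an inexact gradient `g` decreases the objective, up to the
squared error of `g`. -/
theorem sq_norm_gradient_le_of_inexact_step
    {E : Type*} [NormedAddCommGroup E] [InnerProductSpace ℝ E] [CompleteSpace E]
    {F : E → ℝ} {C η : ℝ} (hF : Differentiable ℝ F)
    (hLip : ∀ x y, ‖gradient F x - gradient F y‖ ≤ C * ‖x - y‖)
    (hη : 0 < η) (hηC : η * C ≤ 1 / 4) (x g : E) :
    η * ‖gradient F x‖ ^ 2 ≤
      4 * (F x - F (x - η • g)) + 4 * η * ‖g - gradient F x‖ ^ 2 := by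
  have hdesc := le_quadratic_of_lipschitz_gradient hF hLip x (-(η • g))
  rw [← sub_eq_add_neg, inner_neg_right, real_inner_smul_right, norm_neg, norm_smul,
    Real.norm_of_nonneg hη.le, mul_pow] at hdesc
  have hstep : η * C * (η * ‖g‖ ^ 2) ≤ 1 / 4 * (η * ‖g‖ ^ 2) :=
    mul_le_mul_of_nonneg_right hηC (by positivity)
  have hsub := norm_sub_sq_real g (gradient F x)
  have hadd := norm_add_sq_real g (gradient F x)
  rw [real_inner_comm] at hsub hadd
  have hpoly : 0 ≤ η * (4 * ‖g - gradient F x‖ ^ 2 - ‖gradient F x‖ ^ 2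
      + 4 * inner ℝ (gradient F x) g - ‖g‖ ^ 2 / 2) := by
    refine mul_nonneg hη.le ?_
    nlinarith [sq_nonneg ‖g - gradient F x‖, sq_nonneg ‖g + gradient F x‖, sq_nonneg ‖g‖,
      sq_nonneg ‖gradient F x‖]
  linarith


theorem inexact_gradient_descent_stationarity
    {E : Type*} [NormedAddCommGroup E] [InnerProductSpace ℝ E] [CompleteSpace E]
    (F : E → ℝ) (C₁ Fstar : ℝ) (hC₁ : 0 < C₁) (hF : Differentiable ℝ F)
    (hLip : ∀ x y, ‖gradient F x - gradient F y‖ ≤ C₁ * ‖x - y‖)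
    (hbdd : ∀ x, Fstar ≤ F x)
    (η : ℝ) (hη : 0 < η) (hηC : η * C₁ ≤ 1 / 4)
    (G : ℕ → E) (w : ℕ → E)
    (hw : ∀ k, 1 ≤ k → w k = w (k - 1) - η • G k)
    (T : ℕ) (hT : 1 ≤ T) :
    (1 / (T : ℝ)) * ∑ k ∈ Finset.Icc 1 T, ‖gradient F (w (k - 1))‖ ^ 2 ≤
      4 * (F (w 0) - Fstar) / (η * T)
        + (4 / (T : ℝ)) * ∑ k ∈ Finset.Icc 1 T, ‖G k - gradient F (w (k - 1))‖ ^ 2 := by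
  have hstep : ∀ k ∈ Finset.Icc 1 T, η * ‖gradient F (w (k - 1))‖ ^ 2 ≤
      4 * (F (w (k - 1)) - F (w k)) + 4 * η * ‖G k - gradient F (w (k - 1))‖ ^ 2 := by
    intro k hk
    rw [hw k (Finset.mem_Icc.1 hk).1]
    exact sq_norm_gradient_le_of_inexact_step hF hLip hη hηC _ _
  have htel : ∑ k ∈ Finset.Icc 1 T, (F (w (k - 1)) - F (w k)) = F (w 0) - F (w T) := by
    rw [← Finset.Ico_add_one_right_eq_Icc, Finset.sum_Ico_eq_sum_range]
    simpa [add_comm] using Finset.sum_range_sub' (fun k ↦ F (w k)) T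
  have hsum := Finset.sum_le_sum hstep
  rw [Finset.sum_add_distrib, ← Finset.mul_sum, ← Finset.mul_sum, ← Finset.mul_sum,
    htel] at hsum
  have hT' : (0 : ℝ) < T := by exact_mod_cast hT
  calc
    _ = η * (∑ k ∈ Finset.Icc 1 T, ‖gradient F (w (k - 1))‖ ^ 2) / (η * T) := by field_simp
    _ ≤ (4 * (F (w 0) - Fstar)
        + 4 * η * ∑ k ∈ Finset.Icc 1 T, ‖G k - gradient F (w (k - 1))‖ ^ 2) / (η * T) := by
      gcongr
      linarith [hbdd (w T)]
    _ = _ := by field_simp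
end
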